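/- Let b be a rational function in the closed unit ball of H∞ with ‖b‖∞ = 1 that is not a finite Blaschke product, with pythagorean mate a whose distinct zeros on T are ξ₁,…,ξ_n with multiplicities m₁,…,m_n. For every φ ∈ H(b) ∩ H∞, the function ψ(z) = ∏_{j=1}^n ((φ(z) − φ(ξ_j))/(z − ξ_j))^{m_j} belongs to the Hardy space H². -/

import Mathlib

open Complex MeasureTheory Set Filter

noncomputable section

attribute [local instance] Classical.propDecidable

/-- The open unit disk in `ℂ`. -/
def unitDisk : Set ℂ := Metric.ball 0 1

/-- The unit circle in `ℂ`. -/
def unitCircle : Set ℂ := Metric.sphere 0 1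

/-- Membership in `H^∞`: analytic and bounded on the unit disk. -/
def MemHinf (f : ℂ → ℂ) : Prop :=
  DifferentiableOn ℂ f unitDisk ∧ ∃ C : ℝ, ∀ z ∈ unitDisk, ‖f z‖ ≤ C

/-- Membership in the closed unit ball of `H^∞`. -/
def MemBallHinf (f : ℂ → ℂ) : Prop :=
  DifferentiableOn ℂ f unitDisk ∧ ∀ z ∈ unitDisk, ‖f z‖ ≤ 1

/-- `f` agrees on the closed unit disk with a rational function without poles there. -/
def IsRationalOnDisk (f : ℂ → ℂ) : Prop :=
  ∃ P Q : Polynomial ℂ, ∀ z ∈ Metric.closedBall (0:ℂ) 1,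
    Q.eval z ≠ 0 ∧ f z = P.eval z / Q.eval z

/-- `f` is a finite Blaschke product (multiplicities are encoded by repetition). -/
def IsFiniteBlaschke (f : ℂ → ℂ) : Prop :=
  ∃ (γ : ℂ) (k : ℕ) (lam : Fin k → ℂ), ‖γ‖ = 1 ∧ (∀ i, lam i ∈ unitDisk) ∧
    ∀ z ∈ unitDisk, f z = γ * ∏ i, (z - lam i) / (1 - (starRingEnd ℂ) (lam i) * z)

/-- The `k`-th Taylor coefficient of `f` at the origin. -/
def taylorCoeff (f : ℂ → ℂ) (k : ℕ) : ℂ := iteratedDeriv k f 0 / k.factorial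

/-- Membership in the Hardy space `H²` (square-summable Taylor coefficients). -/
def MemH2 (f : ℂ → ℂ) : Prop :=
  DifferentiableOn ℂ f unitDisk ∧ Summable fun k => ‖taylorCoeff f k‖ ^ 2

/-- The squared `H²` norm. -/
def h2NormSq (f : ℂ → ℂ) : ℝ := ∑' k, ‖taylorCoeff f k‖ ^ 2

/-- The `H²` inner product. -/
def h2Inner (f g : ℂ → ℂ) : ℂ :=
  ∑' k, (starRingEnd ℂ) (taylorCoeff f k) * taylorCoeff g k

/-- The polynomial `a₁(z) = ∏ⱼ (z − ξⱼ)^{mⱼ}`. -/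
def a1fun {n : ℕ} (ξ : Fin n → ℂ) (m : Fin n → ℕ) : ℂ → ℂ :=
  fun z => ∏ j, (z - ξ j) ^ (m j)

/-- A decomposition `f = a₁ g + q` with `g ∈ H²`, `deg q ≤ N − 1`, witnessing membership
in `H(b) = a₁H² ⊕ P_{N−1}`. -/
def HbDecompOf {n : ℕ} (ξ : Fin n → ℂ) (m : Fin n → ℕ)
    (f g : ℂ → ℂ) (q : Polynomial ℂ) : Prop :=
  MemH2 g ∧ q.degree < ((∑ j, m j : ℕ) : WithBot ℕ) ∧
    ∀ z ∈ unitDisk, f z = a1fun ξ m z * g z + q.eval z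

/-- Membership in `H(b) = a₁ H² ⊕ P_{N−1}` (description of `H(b)` for `b` rational,
not a finite Blaschke product, whose pythagorean mate has boundary zeros `ξ` with
multiplicities `m`). -/
def MemHb {n : ℕ} (ξ : Fin n → ℂ) (m : Fin n → ℕ) (f : ℂ → ℂ) : Prop :=
  ∃ gq : (ℂ → ℂ) × Polynomial ℂ, HbDecompOf ξ m f gq.1 gq.2

/-- The (unique) decomposition of a member of `H(b)`. -/
def hbDecomp {n : ℕ} (ξ : Fin n → ℂ) (m : Fin n → ℕ) (f : ℂ → ℂ) :
    (ℂ → ℂ) × Polynomial ℂ :=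
  if h : MemHb ξ m f then h.choose else (0, 0)

/-- The squared norm `⦀a₁g + q⦀² = ‖g‖²_{H²} + ‖q‖²_{H²}` on `H(b)`. -/
def hbNormSq {n : ℕ} (ξ : Fin n → ℂ) (m : Fin n → ℕ) (f : ℂ → ℂ) : ℝ :=
  h2NormSq (hbDecomp ξ m f).1 + h2NormSq fun z => ((hbDecomp ξ m f).2).eval z

/-- The inner product on `H(b)` induced by the decomposition. -/
def hbInner {n : ℕ} (ξ : Fin n → ℂ) (m : Fin n → ℕ) (f g : ℂ → ℂ) : ℂ :=
  h2Inner (hbDecomp ξ m f).1 (hbDecomp ξ m g).1 +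
    h2Inner (fun z => ((hbDecomp ξ m f).2).eval z)
      (fun z => ((hbDecomp ξ m g).2).eval z)

/-- The Stolz angle (non-tangential approach region) at a boundary point `ξ`. -/
def stolzAngle (ξ : ℂ) (M : ℝ) : Set ℂ := {z ∈ unitDisk | ‖z - ξ‖ ≤ M * (1 - ‖z‖)}

/-- `f` has non-tangential limit `L` at `ξ`. -/
def NTLimit (f : ℂ → ℂ) (ξ L : ℂ) : Prop :=
  ∀ M : ℝ, 1 < M → Tendsto f (nhdsWithin ξ (stolzAngle ξ M)) (nhds L)

/-- Radial boundary value of `f` at `ζ` (junk value if the radial limit does not exist). -/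
def bdryVal (f : ℂ → ℂ) (ζ : ℂ) : ℂ :=
  limUnder (nhdsWithin (1:ℝ) (Set.Iio 1)) fun r : ℝ => f ((r : ℂ) * ζ)

/-- The full setting: `b` is a rational function in the closed unit ball of `H^∞` with
`‖b‖_∞ = 1` which is not a finite Blaschke product; `a` is its pythagorean mate (rational,
outer — i.e. zero-free on the disk —, `a(0) > 0`, `|a|² + |b|² = 1` on the circle); the
`ξ j` are the distinct zeros of `a` on the unit circle, with multiplicities `m j`. -/
structure RationalSetting (b a : ℂ → ℂ) (n : ℕ) (ξ : Fin n → ℂ) (m : Fin n → ℕ) :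
    Prop where
  b_diff : DifferentiableOn ℂ b unitDisk
  b_rat : IsRationalOnDisk b
  b_le_one : ∀ z ∈ unitDisk, ‖b z‖ ≤ 1
  b_norm_one : sSup ((fun z => ‖b z‖) '' unitDisk) = 1
  b_not_fbp : ¬ IsFiniteBlaschke b
  a_diff : DifferentiableOn ℂ a unitDisk
  a_rat : IsRationalOnDisk a
  a_outer : ∀ z ∈ unitDisk, a z ≠ 0
  a_zero_pos : 0 < (a 0).re ∧ (a 0).im = 0
  pyth : ∀ ζ ∈ unitCircle, ‖a ζ‖ ^ 2 + ‖b ζ‖ ^ 2 = 1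
  zeros_mem : ∀ j, ξ j ∈ unitCircle
  zeros_inj : Function.Injective ξ
  mult_pos : ∀ j, 0 < m j
  factor : ∃ g : ℂ → ℂ, IsRationalOnDisk g ∧ (∀ ζ ∈ unitCircle, g ζ ≠ 0) ∧
    ∀ z ∈ Metric.closedBall (0:ℂ) 1, a z = a1fun ξ m z * g z

/-- The composition operator `C_φ` maps `H(b)` into itself and is bounded there
(with respect to the equivalent norm `⦀·⦀_b`). -/
def CompBddHb {n : ℕ} (ξ : Fin n → ℂ) (m : Fin n → ℕ) (φ : ℂ → ℂ) : Prop :=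
  (∀ f, MemHb ξ m f → MemHb ξ m fun z => f (φ z)) ∧
  ∃ C : ℝ, ∀ f, MemHb ξ m f →
    hbNormSq ξ m (fun z => f (φ z)) ≤ C * hbNormSq ξ m f

/-- The composition operator `C_φ` is compact on `H(b)`: it is bounded and the image of
every sequence in the unit ball has a subsequence whose image converges in `H(b)`. -/
def CompCompactHb {n : ℕ} (ξ : Fin n → ℂ) (m : Fin n → ℕ) (φ : ℂ → ℂ) : Prop :=
  CompBddHb ξ m φ ∧
  ∀ f : ℕ → ℂ → ℂ, (∀ k, MemHb ξ m (f k) ∧ hbNormSq ξ m (f k) ≤ 1) →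
    ∃ (κ : ℕ → ℕ) (g : ℂ → ℂ), StrictMono κ ∧ MemHb ξ m g ∧
      Tendsto (fun i => hbNormSq ξ m fun z => f (κ i) (φ z) - g z) atTop (nhds 0)

/-- The composition operator `C_φ` is Hilbert–Schmidt on `H(b)`: it is bounded and the sum
of `⦀C_φ e⦀²` over the orthonormal basis `{a₁ z^k}ₖ ∪ {z^j}_{j<N}` of
`(H(b), ⦀·⦀_b)` is finite (the finite part of the sum being automatically finite). -/
def CompHSHb {n : ℕ} (ξ : Fin n → ℂ) (m : Fin n → ℕ) (φ : ℂ → ℂ) : Prop :=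
  CompBddHb ξ m φ ∧
  Summable fun k : ℕ => hbNormSq ξ m fun z => a1fun ξ m (φ z) * φ z ^ k

/-- The weighted composition operator `W_{u,φ} f = u · (f ∘ φ)` maps `H²` boundedly
into itself. -/
def WCompBddH2 (u φ : ℂ → ℂ) : Prop :=
  (∀ f, MemH2 f → MemH2 fun z => u z * f (φ z)) ∧
  ∃ C : ℝ, ∀ f, MemH2 f →
    h2NormSq (fun z => u z * f (φ z)) ≤ C * h2NormSq f

/-- The weighted composition operator `W_{u,φ}` is compact on `H²`. -/
def WCompCompactH2 (u φ : ℂ → ℂ) : Prop :=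
  WCompBddH2 u φ ∧
  ∀ f : ℕ → ℂ → ℂ, (∀ k, MemH2 (f k) ∧ h2NormSq (f k) ≤ 1) →
    ∃ (κ : ℕ → ℕ) (g : ℂ → ℂ), StrictMono κ ∧ MemH2 g ∧
      Tendsto (fun i => h2NormSq fun z => u z * f (κ i) (φ z) - g z) atTop (nhds 0)

/-- The weighted composition operator `W_{u,φ}` is Hilbert–Schmidt on `H²`
(sum over the orthonormal basis `{z^k}` of `H²`). -/
def WCompHSH2 (u φ : ℂ → ℂ) : Prop :=
  WCompBddH2 u φ ∧ Summable fun k : ℕ => h2NormSq fun z => u z * φ z ^ k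

/-- The function `u = (a₁ ∘ φ) · ∏_{j ≥ p} (φ − φ(ξⱼ))^{mⱼ} / a₁`, where `Λ j = φ(ξ j)`
are the non-tangential limits of `φ` at the zeros of the mate. -/
def ufun {n : ℕ} (p : ℕ) (ξ : Fin n → ℂ) (m : Fin n → ℕ) (Λ : Fin n → ℂ)
    (φ : ℂ → ℂ) : ℂ → ℂ :=
  fun z => a1fun ξ m (φ z) *
    (∏ j ∈ Finset.univ.filter fun j : Fin n => p ≤ (j : ℕ), (φ z - Λ j) ^ (m j)) /
      a1fun ξ m z

/-- The reproducing kernel of the de Branges–Rovnyak space `H(c)`: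
`k_λ^c(z) = (1 − conj(c(λ)) c(z)) / (1 − conj(λ) z)`, as a function of the parameter `λ`
and the evaluation point `z`. -/
def rkKernel (c : ℂ → ℂ) (lam z : ℂ) : ℂ :=
  (1 - (starRingEnd ℂ) (c lam) * c z) / (1 - (starRingEnd ℂ) lam * z)

/-- `f` belongs to the reproducing kernel Hilbert space `H(c)` with squared norm at
most `t`: for all finite linear combinations of kernels,
`|⟨f, Σ αᵢ k_{λᵢ}⟩|² ≤ t · ‖Σ αᵢ k_{λᵢ}‖²`. -/
def HbRKBound (c f : ℂ → ℂ) (t : ℝ) : Prop :=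
  ∀ (k : ℕ) (lam α : Fin k → ℂ), (∀ i, lam i ∈ unitDisk) →
    ‖∑ i, (starRingEnd ℂ) (α i) * f (lam i)‖ ^ 2 ≤
      t * (∑ i, ∑ j, α i * (starRingEnd ℂ) (α j) * rkKernel c (lam i) (lam j)).re

/-- Membership in the de Branges–Rovnyak space `H(c)` (general RKHS definition). -/
def MemHbRK (c f : ℂ → ℂ) : Prop := ∃ t : ℝ, HbRKBound c f t

/-- `φ` has an angular derivative in the sense of Carathéodory at `ξ`:
`φ` and `φ'` have non-tangential limits at `ξ` and `|φ(ξ)| = 1`. -/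
def HasADC (φ : ℂ → ℂ) (ξ : ℂ) : Prop :=
  ∃ L L' : ℂ, ‖L‖ = 1 ∧ NTLimit φ ξ L ∧ NTLimit (deriv φ) ξ L'

/-- The measure `μ_{u,φ}(E) = ∫_{φ⁻¹(E) ∩ T} |u|² dm` (boundary values on the circle,
normalized Lebesgue measure). -/
def muMeas (u φ : ℂ → ℂ) (E : Set ℂ) : ENNReal :=
  (ENNReal.ofReal (2 * Real.pi))⁻¹ *
    ∫⁻ θ in Set.Ioc (0:ℝ) (2 * Real.pi),
      (if bdryVal φ (Complex.exp (θ * Complex.I)) ∈ E then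
        ENNReal.ofReal (‖bdryVal u (Complex.exp (θ * Complex.I))‖ ^ 2) else 0)

/-- `μ_{u,φ}` is a Carleson measure: `μ(S(ζ,r)) ≤ M r` for all Carleson windows
`S(ζ,r) = {z : |z| ≤ 1, |z − ζ| ≤ r}`, `ζ ∈ T`, `0 < r < 1`. -/
def IsCarleson (u φ : ℂ → ℂ) : Prop :=
  ∃ M : ℝ, 0 < M ∧ ∀ ζ ∈ unitCircle, ∀ r ∈ Set.Ioo (0:ℝ) 1,
    muMeas u φ (Metric.closedBall ζ r ∩ Metric.closedBall 0 1) ≤ ENNReal.ofReal (M * r)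

/-- `μ_{u,φ}` is a vanishing Carleson measure: `sup_{ζ∈T} μ(S(ζ,r))/r → 0` as `r → 0`. -/
def IsVanishingCarleson (u φ : ℂ → ℂ) : Prop :=
  ∀ ε > (0:ℝ), ∃ r₀ ∈ Set.Ioo (0:ℝ) 1, ∀ r ∈ Set.Ioo (0:ℝ) r₀, ∀ ζ ∈ unitCircle,
    muMeas u φ (Metric.closedBall ζ r ∩ Metric.closedBall 0 1) ≤ ENNReal.ofReal (ε * r)

/-- The reproducing kernel integral
`∫_T (1 − |w|²) |u(ξ)|² / |1 − conj(w) φ(ξ)|² dm(ξ)`. -/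
def repKerInt (u φ : ℂ → ℂ) (w : ℂ) : ENNReal :=
  (ENNReal.ofReal (2 * Real.pi))⁻¹ *
    ∫⁻ θ in Set.Ioc (0:ℝ) (2 * Real.pi),
      ENNReal.ofReal ((1 - ‖w‖ ^ 2) * ‖bdryVal u (Complex.exp (θ * Complex.I))‖ ^ 2 /
        ‖1 - (starRingEnd ℂ) w * bdryVal φ (Complex.exp (θ * Complex.I))‖ ^ 2)

/-- Absolute convergence of the Taylor series on the disk. -/
lemma aux_hasSum {f : ℂ → ℂ} (hf : DifferentiableOn ℂ f unitDisk) {z : ℂ} (hz : z ∈ unitDisk) :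
    HasSum (fun k => taylorCoeff f k * z ^ k) (f z) := by
  have h := Complex.hasSum_taylorSeries_on_ball hf hz
  have e : (fun k => taylorCoeff f k * z ^ k) =
      fun k : ℕ => (k.factorial : ℂ)⁻¹ • (z - 0) ^ k • iteratedDeriv k f 0 := by
    funext k
    simp only [taylorCoeff, sub_zero, smul_eq_mul]
    ring
  rw [e]
  exact h

/-- Parseval's identity on circles of radius `r < 1`. -/
lemma aux_parseval [Fact ((0:ℝ) < 1)] {f : ℂ → ℂ} (hf : DifferentiableOn ℂ f unitDisk)
    {r : ℝ} (hr0 : 0 ≤ r) (hr1 : r < 1) :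
    Continuous (fun t : AddCircle (1:ℝ) => f (r * (AddCircle.toCircle t : ℂ))) ∧
    HasSum (fun k => ‖taylorCoeff f k‖ ^ 2 * (r ^ 2) ^ k)
      (∫ t : AddCircle (1:ℝ), ‖f (r * (AddCircle.toCircle t : ℂ))‖ ^ 2
        ∂AddCircle.haarAddCircle) := by
  have hmem : ∀ t : AddCircle (1:ℝ), (r * (AddCircle.toCircle t : ℂ)) ∈ unitDisk := by
    intro t
    have := Circle.norm_coe (AddCircle.toCircle t)
    simp only [unitDisk, mem_ball_zero_iff, norm_mul, this, Complex.norm_real, Real.norm_eq_abs,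
      abs_of_nonneg hr0, mul_one, hr1]
  have hcont : Continuous (fun t : AddCircle (1:ℝ) => f (r * (AddCircle.toCircle t : ℂ))) := by
    refine hf.continuousOn.comp_continuous ?_ hmem
    exact continuous_const.mul (continuous_subtype_val.comp AddCircle.continuous_toCircle)
  refine ⟨hcont, ?_⟩
  set F : C(AddCircle (1:ℝ), ℂ) := ⟨_, hcont⟩ with hF
  set c : ℕ → ℂ := fun k => taylorCoeff f k * (r:ℂ) ^ k with hc
  have hcsum : Summable (fun k => ‖c k‖) := by
    have hr : (r:ℂ) ∈ unitDisk := by simp [unitDisk, abs_of_nonneg hr0, hr1]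
    exact (aux_hasSum hf hr).summable.norm
  have hs : Summable (fun k : ℕ => c k • (fourier (k:ℤ) : C(AddCircle (1:ℝ), ℂ))) := by
    apply Summable.of_norm
    simpa only [norm_smul, fourier_norm, mul_one] using hcsum
  have hFs : HasSum (fun k : ℕ => c k • (fourier (k:ℤ) : C(AddCircle (1:ℝ), ℂ))) F := by
    obtain ⟨G, hG⟩ := hs
    have : G = F := by
      ext t
      have h1 := hG.map (ContinuousMap.evalCLM ℂ t) (ContinuousMap.evalCLM ℂ t).continuous
      have h2 := aux_hasSum hf (hmem t)
      refine h1.unique ?_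
      have e : (⇑(ContinuousMap.evalCLM ℂ t) ∘ fun k : ℕ =>
          c k • (fourier (k:ℤ) : C(AddCircle (1:ℝ), ℂ))) =
          fun k => taylorCoeff f k * (r * (AddCircle.toCircle t : ℂ)) ^ k := by
        funext k
        simp [hc, fourier_apply, mul_pow, mul_assoc, AddCircle.toCircle_nsmul]
      rw [e]
      exact h2
    rwa [this] at hG
  let L := ContinuousMap.toLp (E := ℂ) 2 (AddCircle.haarAddCircle (T := (1:ℝ))) ℂ
  have hL : HasSum (fun k : ℕ => c k • fourierLp (T := (1:ℝ)) 2 (k:ℤ)) (L F) := by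
    have := hFs.mapL L
    simpa [L, fourierLp] using this
  have hinner : ∀ k : ℕ, inner ℂ (fourierLp (T := (1:ℝ)) 2 (k:ℤ)) (L F) = c k := by
    intro k
    have h1 := hL.mapL (innerSL ℂ (fourierLp (T := (1:ℝ)) 2 (k:ℤ)))
    have e : (fun i : ℕ => innerSL ℂ (fourierLp (T := (1:ℝ)) 2 (k:ℤ))
        (c i • fourierLp (T := (1:ℝ)) 2 (i:ℤ))) = fun i => if i = k then c k else 0 := by
      funext i
      have := orthonormal_iff_ite.1 (orthonormal_fourier (T := (1:ℝ))) (k:ℤ) (i:ℤ)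
      rw [innerSL_apply_apply, inner_smul_right, this]
      by_cases h : i = k
      · simp [h]
      · have : ¬ ((k:ℤ) = i) := by omega
        simp [h, this]
    rw [e] at h1
    exact HasSum.unique h1 (hasSum_ite_eq k (c k))
  have h2 := hL.mapL (innerSL ℂ (L F))
  have e1 : (fun k : ℕ => innerSL ℂ (L F) (c k • fourierLp (T := (1:ℝ)) 2 (k:ℤ))) =
      fun k : ℕ => ((‖taylorCoeff f k‖ ^ 2 * (r ^ 2) ^ k : ℝ) : ℂ) := by
    funext k
    rw [innerSL_apply_apply, inner_smul_right, ← inner_conj_symm, hinner k, RCLike.mul_conj]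
    simp only [hc, norm_mul, norm_pow, Complex.norm_real, Real.norm_eq_abs, abs_of_nonneg hr0]
    push_cast
    simp
    ring
  have e2 : innerSL ℂ (L F) (L F) =
      ((∫ t : AddCircle (1:ℝ), ‖f (r * (AddCircle.toCircle t : ℂ))‖ ^ 2
        ∂AddCircle.haarAddCircle : ℝ) : ℂ) := by
    rw [innerSL_apply_apply, ContinuousMap.inner_toLp, ← integral_complex_ofReal]
    congr 1
    funext t
    rw [RCLike.mul_conj]
    simp [hF]
  rw [e1, e2] at h2
  have h3 : HasSum (fun k : ℕ => ((‖taylorCoeff f k‖ ^ 2 * (r ^ 2) ^ k : ℝ) : ℂ))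
      ((∫ t : AddCircle (1:ℝ), ‖f (r * (AddCircle.toCircle t : ℂ))‖ ^ 2
        ∂AddCircle.haarAddCircle : ℝ) : ℂ) := h2
  exact_mod_cast h3

/-- Domination criterion for membership in `H²`. -/
lemma aux_dom {f g : ℂ → ℂ} (hf : DifferentiableOn ℂ f unitDisk) (hg : MemH2 g)
    (A D : ℝ) (hD : 0 ≤ D)
    (h : ∀ z ∈ unitDisk, ‖f z‖ ^ 2 ≤ A + D * ‖g z‖ ^ 2) : MemH2 f := by
  refine ⟨hf, ?_⟩
  have : Fact ((0:ℝ) < 1) := ⟨one_pos⟩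
  refine summable_of_sum_range_le (c := A + D * ∑' k, ‖taylorCoeff g k‖ ^ 2)
    (fun _ => by positivity) ?_
  intro K
  have key : ∀ r : ℝ, 0 ≤ r → r < 1 →
      ∑ k ∈ Finset.range K, ‖taylorCoeff f k‖ ^ 2 * (r ^ 2) ^ k ≤
        A + D * ∑' k, ‖taylorCoeff g k‖ ^ 2 := by
    intro r hr0 hr1
    obtain ⟨hfc, hfs⟩ := aux_parseval hf hr0 hr1
    obtain ⟨hgc, hgs⟩ := aux_parseval hg.1 hr0 hr1
    have h1 := sum_le_hasSum (Finset.range K) (fun i _ => by positivity) hfs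
    refine h1.trans ?_
    have h2 : (∫ t : AddCircle (1:ℝ), ‖g (r * (AddCircle.toCircle t : ℂ))‖ ^ 2
        ∂AddCircle.haarAddCircle) ≤ ∑' k, ‖taylorCoeff g k‖ ^ 2 := by
      refine hasSum_le (fun k => ?_) hgs hg.2.hasSum
      exact mul_le_of_le_one_right (by positivity)
        (pow_le_one₀ (by positivity) (pow_le_one₀ hr0 hr1.le))
    have hgi : Integrable (fun t : AddCircle (1:ℝ) => ‖g (r * (AddCircle.toCircle t : ℂ))‖ ^ 2)
        AddCircle.haarAddCircle :=
      (hgc.norm.pow 2).integrable_of_hasCompactSupport (HasCompactSupport.of_compactSpace _)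
    have hfi : Integrable (fun t : AddCircle (1:ℝ) => ‖f (r * (AddCircle.toCircle t : ℂ))‖ ^ 2)
        AddCircle.haarAddCircle :=
      (hfc.norm.pow 2).integrable_of_hasCompactSupport (HasCompactSupport.of_compactSpace _)
    calc _ ≤ ∫ t : AddCircle (1:ℝ), (A + D * ‖g (r * (AddCircle.toCircle t : ℂ))‖ ^ 2)
          ∂AddCircle.haarAddCircle := by
            refine integral_mono hfi ((integrable_const A).add (hgi.const_mul D)) ?_
            intro t
            refine h _ ?_
            have := Circle.norm_coe (AddCircle.toCircle t)
            simp only [unitDisk, mem_ball_zero_iff, norm_mul, this, Complex.norm_real,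
              Real.norm_eq_abs, abs_of_nonneg hr0, mul_one, hr1]
      _ = A + D * ∫ t : AddCircle (1:ℝ), ‖g (r * (AddCircle.toCircle t : ℂ))‖ ^ 2
          ∂AddCircle.haarAddCircle := by
            rw [integral_add (integrable_const A) (hgi.const_mul D), integral_const_mul]
            simp
      _ ≤ _ := by gcongr
  have hlim : Tendsto (fun r : ℝ => ∑ k ∈ Finset.range K, ‖taylorCoeff f k‖ ^ 2 * (r ^ 2) ^ k)
      (nhdsWithin 1 (Iio 1)) (nhds (∑ k ∈ Finset.range K, ‖taylorCoeff f k‖ ^ 2)) := by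
    have hc : Continuous
        (fun r : ℝ => ∑ k ∈ Finset.range K, ‖taylorCoeff f k‖ ^ 2 * (r ^ 2) ^ k) := by fun_prop
    have := (hc.tendsto 1).mono_left (nhdsWithin_le_nhds (s := Iio 1))
    simpa using this
  refine le_of_tendsto hlim ?_
  filter_upwards [self_mem_nhdsWithin, mem_nhdsWithin_of_mem_nhds (lt_mem_nhds one_pos)]
    with r h1 h0
  exact key r (le_of_lt h0) h1

/-- Growth of `H²` functions. -/
lemma aux_growth {g : ℂ → ℂ} (hg : MemH2 g) {s : ℝ} (hs0 : 0 < s) (hs1 : s < 1) {ζ : ℂ}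
    (hζ : ‖ζ‖ = 1) :
    s ^ 2 * ‖g (((1 - s ^ 2 : ℝ) : ℂ) * ζ)‖ ≤ s * (∑' k, ‖taylorCoeff g k‖ ^ 2 + 1) := by
  set r : ℝ := 1 - s ^ 2 with hr
  have hr0 : 0 ≤ r := by nlinarith
  have hr1 : r < 1 := by nlinarith
  have hn : ‖(r:ℂ) * ζ‖ = r := by simp [hζ, abs_of_nonneg hr0]
  have hz : (r:ℂ) * ζ ∈ unitDisk := by
    simpa [unitDisk, hζ, abs_of_nonneg hr0] using hr1
  have h1 := aux_hasSum hg.1 hz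
  have hgeo := (hasSum_geometric_of_lt_one hr0 hr1).mul_left s
  have h2 := (hg.2.hasSum.mul_left (1 / s)).add hgeo
  have h3 : ‖g ((r:ℂ) * ζ)‖ ≤ 1 / s * ∑' k, ‖taylorCoeff g k‖ ^ 2 + s * (1 - r)⁻¹ := by
    rw [← h1.tsum_eq]
    refine tsum_of_norm_bounded h2 ?_
    intro k
    rw [norm_mul, norm_pow, hn]
    have hp : 0 ≤ r ^ k := by positivity
    have hp1 : r ^ k ≤ 1 := pow_le_one₀ hr0 hr1.le
    set x := ‖taylorCoeff g k‖
    set y := r ^ k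
    have : 1 / s * x ^ 2 + s * y - x * y = ((x - s * y / 2) ^ 2 + s ^ 2 * (y - y ^ 2 / 4)) / s := by
      field_simp
      ring
    have h4 : 0 ≤ y - y ^ 2 / 4 := by nlinarith
    have h5 : 0 ≤ ((x - s * y / 2) ^ 2 + s ^ 2 * (y - y ^ 2 / 4)) / s := by positivity
    linarith
  have h6 : 1 - r = s ^ 2 := by rw [hr]; ring
  rw [h6] at h3
  calc s ^ 2 * ‖g ((r:ℂ) * ζ)‖
      ≤ s ^ 2 * (1 / s * ∑' k, ‖taylorCoeff g k‖ ^ 2 + s * (s ^ 2)⁻¹) := by gcongr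
    _ = _ := by field_simp

/-- The polynomial part takes the values of the non-tangential limits. -/
lemma aux_value {n : ℕ} {ξ : Fin n → ℂ} {m : Fin n → ℕ} {φ g : ℂ → ℂ} {q : Polynomial ℂ}
    (hd : HbDecompOf ξ m φ g q) (hmem : ∀ j, ξ j ∈ unitCircle) (hm : ∀ j, 0 < m j)
    (j : Fin n) {L : ℂ} (hL : NTLimit φ (ξ j) L) : q.eval (ξ j) = L := by
  have hζ : ‖ξ j‖ = 1 := by simpa [unitCircle] using hmem j
  let l : Filter ℝ := nhdsWithin 0 (Ioi 0)
  let z : ℝ → ℂ := fun s => ((1 - s ^ 2 : ℝ) : ℂ) * ξ j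
  have hev : ∀ᶠ s in l, 0 < s ∧ s < 1 := by
    filter_upwards [self_mem_nhdsWithin, mem_nhdsWithin_of_mem_nhds (gt_mem_nhds one_pos)]
      with s h0 h1
    exact ⟨h0, h1⟩
  have hzc : Continuous z := by
    simp only [z]
    fun_prop
  have hzl : Tendsto z l (nhds (ξ j)) := by
    have := (hzc.tendsto 0).mono_left (nhdsWithin_le_nhds (s := Ioi 0))
    simpa [z] using this
  have hzn : ∀ s, 0 < s → s < 1 → ‖z s‖ = 1 - s ^ 2 := by
    intro s h0 h1
    have : 0 ≤ 1 - s ^ 2 := by nlinarith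
    simp only [z, norm_mul, hζ, mul_one, Complex.norm_real, Real.norm_eq_abs]
    exact abs_of_nonneg this
  have hzd : ∀ s, 0 < s → s < 1 → z s ∈ unitDisk := by
    intro s h0 h1
    simp only [unitDisk, mem_ball_zero_iff, hzn s h0 h1]
    nlinarith
  have hdiff : ∀ s, ‖z s - ξ j‖ = s ^ 2 := by
    intro s
    have : z s - ξ j = ((-(s ^ 2) : ℝ) : ℂ) * ξ j := by simp only [z]; push_cast; ring
    rw [this, norm_mul, hζ, Complex.norm_real]
    simp
  have hst : Tendsto z l (nhdsWithin (ξ j) (stolzAngle (ξ j) 2)) := by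
    refine tendsto_nhdsWithin_iff.2 ⟨hzl, ?_⟩
    filter_upwards [hev] with s hs
    refine ⟨hzd s hs.1 hs.2, ?_⟩
    rw [hdiff, hzn s hs.1 hs.2]
    nlinarith [sq_nonneg s]
  have h1 : Tendsto (fun s => φ (z s)) l (nhds L) := (hL 2 (by norm_num)).comp hst
  have h2 : Tendsto (fun s => q.eval (z s)) l (nhds (q.eval (ξ j))) :=
    (q.continuous.tendsto _).comp hzl
  have h3 : Tendsto (fun s => a1fun ξ m (z s) * g (z s)) l (nhds 0) := by
    let R : ℂ → ℂ := fun w => (w - ξ j) ^ (m j - 1) * ∏ i ∈ Finset.univ.erase j, (w - ξ i) ^ (m i)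
    have hR : ∀ w, a1fun ξ m w = (w - ξ j) * R w := by
      intro w
      simp only [a1fun, R]
      rw [← Finset.mul_prod_erase _ _ (Finset.mem_univ j), ← mul_assoc, ← pow_succ',
        Nat.sub_add_cancel (hm j)]
    have hRc : Continuous R := by simp only [R]; fun_prop
    have hRl : Tendsto (fun s => ‖R (z s)‖) l (nhds ‖R (ξ j)‖) :=
      ((hRc.tendsto _).comp hzl).norm
    have hsl : Tendsto (fun s : ℝ => s * (∑' k, ‖taylorCoeff g k‖ ^ 2 + 1)) l (nhds 0) := by
      have hc : Continuous (fun s : ℝ => s * (∑' k, ‖taylorCoeff g k‖ ^ 2 + 1)) := by fun_prop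
      have := (hc.tendsto 0).mono_left (nhdsWithin_le_nhds (s := Ioi 0))
      simpa using this
    have hb := hRl.mul hsl
    rw [mul_zero] at hb
    refine squeeze_zero_norm' ?_ hb
    filter_upwards [hev] with s hs
    rw [hR, norm_mul, norm_mul, hdiff]
    have := aux_growth hd.1 hs.1 hs.2 hζ
    calc s ^ 2 * ‖R (z s)‖ * ‖g (z s)‖ = ‖R (z s)‖ * (s ^ 2 * ‖g (z s)‖) := by ring
      _ ≤ _ := by gcongr
  have h4 : Tendsto (fun s => φ (z s)) l (nhds (0 + q.eval (ξ j))) := by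
    refine (h3.add h2).congr' ?_
    filter_upwards [hev] with s hs
    exact (hd.2.2 _ (hzd s hs.1 hs.2)).symm
  rw [zero_add] at h4
  exact tendsto_nhds_unique h4 h1

/-- Polynomials are Lipschitz on bounded sets. -/
lemma aux_lip (P : Polynomial ℂ) (R : ℝ) : ∃ C : ℝ, 0 ≤ C ∧ ∀ x y : ℂ, ‖x‖ ≤ R → ‖y‖ ≤ R →
    ‖P.eval x - P.eval y‖ ≤ C * ‖x - y‖ := by
  obtain ⟨C, hC⟩ := (isCompact_closedBall (0:ℂ) R).exists_bound_of_continuousOn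
    (P.derivative.continuous.continuousOn)
  refine ⟨max C 0, le_max_right _ _, fun x y hx hy => ?_⟩
  refine Convex.norm_image_sub_le_of_norm_deriv_le (𝕜 := ℂ) (f := fun w => P.eval w)
    (s := Metric.closedBall (0:ℂ) R)
    (fun w _ => P.differentiable w) ?_ (convex_closedBall _ _) (by simpa using hy) (by simpa using hx)
  intro w hw
  rw [Polynomial.deriv]
  exact (hC w hw).trans (le_max_left _ _)

/-- Lemma 2.3. For `φ ∈ H(b) ∩ H^∞`, the function
`ψ(z) = ∏ⱼ ((φ(z) − φ(ξⱼ))/(z − ξⱼ))^{mⱼ}` belongs to `H²`, where `φ(ξⱼ)` is the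
non-tangential limit of `φ` at `ξⱼ`. -/
theorem psi_mem_H2
    (b a : ℂ → ℂ) (n : ℕ) (ξ : Fin n → ℂ) (m : Fin n → ℕ)
    (hset : RationalSetting b a n ξ m)
    (φ : ℂ → ℂ) (hφb : MemHb ξ m φ) (hφinf : MemHinf φ)
    (Λ : Fin n → ℂ) (hΛ : ∀ j, NTLimit φ (ξ j) (Λ j)) :
    MemH2 fun z => ∏ j, ((φ z - Λ j) / (z - ξ j)) ^ (m j) := by
  obtain ⟨⟨g, q⟩, hd⟩ := hφb
  simp only at hd
  obtain ⟨hφd, C0, hC0⟩ := hφinf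
  have hne : ∀ z ∈ unitDisk, ∀ j, z - ξ j ≠ 0 := by
    intro z hz j h
    have h1 : ‖ξ j‖ = 1 := by simpa [unitCircle] using hset.zeros_mem j
    have h2 : ‖z‖ < 1 := by simpa [unitDisk] using hz
    rw [sub_eq_zero.1 h] at h2
    linarith
  have hval : ∀ j, q.eval (ξ j) = Λ j := fun j =>
    aux_value hd hset.zeros_mem hset.mult_pos j (hΛ j)
  have hfac : ∀ j, ∃ p : Polynomial ℂ, q - Polynomial.C (Λ j) =
      (Polynomial.X - Polynomial.C (ξ j)) * p := by
    intro j
    have : (Polynomial.X - Polynomial.C (ξ j)) ∣ q - Polynomial.C (Λ j) := by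
      rw [Polynomial.dvd_iff_isRoot]
      simp [hval j]
    exact this
  choose p hp using hfac
  have hp' : ∀ j z, q.eval z - Λ j = (z - ξ j) * (p j).eval z := by
    intro j z
    simpa using congrArg (Polynomial.eval z) (hp j)
  let H : Polynomial ℂ := ∏ j, (p j) ^ (m j)
  let P : Polynomial ℂ := ∏ j, (Polynomial.X - Polynomial.C (Λ j)) ^ (m j)
  have hP : ∀ w, P.eval w = ∏ j, (w - Λ j) ^ (m j) := by
    intro w
    simp [P, Polynomial.eval_prod]
  have hPq : ∀ z, P.eval (q.eval z) = a1fun ξ m z * H.eval z := by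
    intro z
    rw [hP]
    simp only [hp', H, a1fun, Polynomial.eval_prod, Polynomial.eval_pow, mul_pow,
      Finset.prod_mul_distrib]
  obtain ⟨Cq, hCq⟩ := (isCompact_closedBall (0:ℂ) 1).exists_bound_of_continuousOn
    (q.continuous.continuousOn)
  obtain ⟨CH, hCH⟩ := (isCompact_closedBall (0:ℂ) 1).exists_bound_of_continuousOn
    (H.continuous.continuousOn)
  obtain ⟨C, hC, hlip⟩ := aux_lip P (max C0 Cq)
  refine aux_dom ?_ hd.1 (2 * CH ^ 2) (2 * C ^ 2) (by positivity) ?_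
  · refine DifferentiableOn.fun_finsetProd fun j _ => ?_
    refine DifferentiableOn.fun_pow ?_ _
    refine DifferentiableOn.fun_div (hφd.sub_const _) (by fun_prop) (fun z hz => hne z hz j)
  · intro z hz
    have hzc : z ∈ Metric.closedBall (0:ℂ) 1 := Metric.ball_subset_closedBall hz
    have ha : a1fun ξ m z ≠ 0 :=
      Finset.prod_ne_zero_iff.2 fun j _ => pow_ne_zero _ (hne z hz j)
    have ha' : 0 < ‖a1fun ξ m z‖ := norm_pos_iff.2 ha
    have hψ : (∏ j, ((φ z - Λ j) / (z - ξ j)) ^ (m j)) =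
        H.eval z + (P.eval (φ z) - P.eval (q.eval z)) / a1fun ξ m z := by
      rw [hPq, hP]
      simp only [div_pow, Finset.prod_div_distrib]
      change _ / a1fun ξ m z = _
      field_simp
      ring
    have hl := hlip (φ z) (q.eval z) ((hC0 z hz).trans (le_max_left _ _))
      ((hCq z hzc).trans (le_max_right _ _))
    have hsub : φ z - q.eval z = a1fun ξ m z * g z := by
      rw [hd.2.2 z hz]; ring
    rw [hsub, norm_mul] at hl
    have h1 : ‖(P.eval (φ z) - P.eval (q.eval z)) / a1fun ξ m z‖ ≤ C * ‖g z‖ := by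
      rw [norm_div, div_le_iff₀ ha']
      linarith
    have h2 : ‖∏ j, ((φ z - Λ j) / (z - ξ j)) ^ (m j)‖ ≤ CH + C * ‖g z‖ := by
      rw [hψ]
      exact (norm_add_le _ _).trans (add_le_add (hCH z hzc) h1)
    calc _ ≤ (CH + C * ‖g z‖) ^ 2 := by gcongr
      _ ≤ _ := by nlinarith [sq_nonneg (CH - C * ‖g z‖)]

end
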